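/- arXiv:2510.17325 — 3 statements merged into one kernel-verified Lean document; each statement's English description precedes it below -/
import Mathlib

section
/- Let 1 < p ≤ 2 and suppose ε has a continuous distribution, the map s ↦ b*_s (the sth L^p-quantile of ε) is continuous on (0,1), and the functions g(s) = E[|s − 1_{ε<b*_s}|·|ε − b*_s|^{p−2}] and h(s,t) = E[(s − 1_{ε<b*_s})(t − 1_{ε<b*_t})·|ε − b*_s|^{p−1}·|ε − b*_t|^{p−1}] are bounded and continuous on (0,1) and (0,1)², respectively. Then, with the equally spaced weights τ_k = k/(K+1), k = 1,…,K, as K → ∞ the ratio (Σ_{k'=1}^K Σ_{k=1}^K E[φ_{τ_{k'},p}(ε − b*_{τ_{k'}}) φ_{τ_k,p}(ε − b*_{τ_k})]) / (Σ_{k=1}^K E[ψ_{τ_k,p}(ε − b*_{τ_k})])² converges to (∫₀¹∫₀¹ h(s,t) ds dt) / ((p−1)² · (∫₀¹ g(s) ds)²). -/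
open MeasureTheory ProbabilityTheory Filter Finset Real

/-- L^p-quantile loss η_{τ,p}(s) = |τ − 1_{s<0}|·|s|^p. -/
noncomputable def etaLp (τ p s : ℝ) : ℝ := |τ - (if s < 0 then (1 : ℝ) else 0)| * |s| ^ p

/-- φ_{τ,p}(s) = p·|τ − 1_{s<0}|·|s|^{p−1}·sign(s). -/
noncomputable def phiLp (τ p s : ℝ) : ℝ :=
  p * |τ - (if s < 0 then (1 : ℝ) else 0)| * |s| ^ (p - 1) * Real.sign s

/-- ψ_{τ,p}(s) = p(p−1)·|τ − 1_{s<0}|·|s|^{p−2}. -/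
noncomputable def psiLp (τ p s : ℝ) : ℝ :=
  p * (p - 1) * |τ - (if s < 0 then (1 : ℝ) else 0)| * |s| ^ (p - 2)

/-- γ is the centered Gaussian law on `n → ℝ` with covariance matrix `S`:
every linear functional pushes γ to the one-dimensional centered Gaussian with the
corresponding variance. -/
def IsCenteredGaussianCov {n : Type*} [Fintype n] (γ : Measure (n → ℝ))
    (S : Matrix n n ℝ) : Prop :=
  ∀ l : n → ℝ, γ.map (fun v => ∑ i, l i * v i) =
    gaussianReal 0 (Real.toNNReal (∑ i, ∑ j, l i * S i j * l j))

/-- The right endpoint of the cell of the grid of mesh `1 / (n + 1)` containing `x`. -/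
noncomputable def ceilGrid (n : ℕ) (x : ℝ) : ℝ := (⌈x * (n + 1)⌉₊ : ℝ) / (n + 1)

theorem tendsto_ceilGrid {x : ℝ} (hx : 0 ≤ x) :
    Tendsto (fun n : ℕ => ceilGrid n x) atTop (nhds x) := by
  have h := (tendsto_nat_ceil_mul_div_atTop hx).comp
    (tendsto_natCast_atTop_atTop.comp (tendsto_add_atTop_nat 1) :
      Tendsto (fun n : ℕ => ((n + 1 : ℕ) : ℝ)) atTop atTop)
  simpa [ceilGrid, Function.comp_def] using h

theorem measurable_comp_ceilGrid (F : ℝ → ℝ) (n : ℕ) :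
    Measurable fun x => F (ceilGrid n x) :=
  (measurable_from_nat (f := fun m : ℕ => F ((m : ℝ) / (n + 1)))).comp
    (Nat.measurable_ceil.comp (measurable_id.mul_const ((n : ℝ) + 1)))

theorem ceilGrid_eq_of_mem_Ioo {n k : ℕ} {x : ℝ}
    (hx : x ∈ Set.Ioo ((k : ℝ) / (n + 1)) ((k + 1 : ℕ) / (n + 1))) :
    ceilGrid n x = (k + 1) / (n + 1) := by
  have hn : (0 : ℝ) < n + 1 := by positivity
  obtain ⟨h1, h2⟩ := hx
  rw [div_lt_iff₀ hn] at h1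
  rw [lt_div_iff₀ hn] at h2
  have h : ⌈x * (n + 1)⌉₊ = k + 1 := by
    rw [Nat.ceil_eq_iff (Nat.succ_ne_zero k)]
    exact ⟨by simpa using h1, h2.le⟩
  simp [ceilGrid, h]

/-- The integral of a step function on the uniform grid is a right Riemann sum. -/
theorem integral_comp_ceilGrid (F : ℝ → ℝ) (n : ℕ) :
    ∫ x in Set.Ioo (0 : ℝ) 1, F (ceilGrid n x) =
      (∑ k ∈ Finset.range (n + 1), F ((k + 1) / (n + 1))) / (n + 1) := by
  have hn : (0 : ℝ) < n + 1 := by positivity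
  have hle (k : ℕ) : (k : ℝ) / (n + 1) ≤ (k + 1 : ℕ) / (n + 1) := by
    gcongr; simp
  have heq (k : ℕ) : Set.EqOn (fun x => F (ceilGrid n x)) (fun _ => F ((k + 1) / (n + 1)))
      (Set.Ioo ((k : ℝ) / (n + 1)) ((k + 1 : ℕ) / (n + 1))) := fun x hx => by
    simp only [ceilGrid_eq_of_mem_Ioo hx]
  have hsum := intervalIntegral.sum_integral_adjacent_intervals (μ := volume)
    (f := fun x => F (ceilGrid n x)) (a := fun k : ℕ => (k : ℝ) / (n + 1)) (n := n + 1)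
    (fun k _ => IntervalIntegrable.congr_uIoo
      (intervalIntegrable_const (c := F ((k + 1) / (n + 1))))
      (by rw [Set.uIoo_of_le (hle k)]; exact (heq k).symm))
  rw [← integral_Ioc_eq_integral_Ioo, ← intervalIntegral.integral_of_le zero_le_one]
  have h1 : ((n + 1 : ℕ) : ℝ) / (n + 1) = 1 := by push_cast; exact div_self hn.ne'
  simp only [h1, Nat.cast_zero, zero_div] at hsum
  rw [← hsum, Finset.sum_div]
  refine Finset.sum_congr rfl fun k _ => ?_
  rw [intervalIntegral.integral_congr_Ioo_of_le (hle k) (heq k),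
    intervalIntegral.integral_const, smul_eq_mul]
  push_cast
  field_simp
  ring

theorem integral_indicator_comp_ceilGrid (f : ℝ → ℝ) (n : ℕ) :
    ∫ x in Set.Ioo (0 : ℝ) 1, (Set.Ioo (0 : ℝ) 1).indicator f (ceilGrid n x) =
      (∑ k ∈ Finset.range n, f ((k + 1) / (n + 1))) / (n + 1) := by
  have hn : (0 : ℝ) < n + 1 := by positivity
  rw [integral_comp_ceilGrid, Finset.sum_range_succ, div_self hn.ne',
    Set.indicator_of_notMem (by simp), add_zero]
  congr 1
  refine Finset.sum_congr rfl fun k hk => Set.indicator_of_mem (Set.mem_Ioo.mpr ?_) f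
  refine ⟨by positivity, ?_⟩
  rw [div_lt_one hn]
  have : (k : ℝ) < n := by exact_mod_cast Finset.mem_range.mp hk
  linarith

/-- Right Riemann sums of a bounded continuous function on the open unit interval converge. -/
theorem tendsto_riemannSum_Ioo {f : ℝ → ℝ} (hf : ContinuousOn f (Set.Ioo 0 1))
    {M : ℝ} (hM : ∀ s ∈ Set.Ioo (0 : ℝ) 1, |f s| ≤ M) :
    Tendsto (fun n : ℕ => (∑ k ∈ Finset.range n, f ((k + 1) / (n + 1))) / (n + 1)) atTop
      (nhds (∫ s in Set.Ioo (0 : ℝ) 1, f s)) := by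
  simp only [← integral_indicator_comp_ceilGrid]
  have hM0 : 0 ≤ M := (abs_nonneg _).trans (hM (1 / 2) (by norm_num))
  refine tendsto_integral_of_dominated_convergence (fun _ => M)
    (fun n => (measurable_comp_ceilGrid _ n).aestronglyMeasurable) (integrable_const M)
    (fun n => ae_of_all _ fun x => ?_) ((ae_restrict_mem measurableSet_Ioo).mono fun x hx => ?_)
  · by_cases h : ceilGrid n x ∈ Set.Ioo (0 : ℝ) 1
    · simpa [Set.indicator_of_mem h] using hM _ h
    · simpa [Set.indicator_of_notMem h] using hM0
  · have hev := (tendsto_ceilGrid hx.1.le).eventually (isOpen_Ioo.mem_nhds hx)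
    refine Tendsto.congr' (hev.mono fun n hn =>
      (Set.indicator_of_mem (s := Set.Ioo (0 : ℝ) 1) hn f).symm) ?_
    exact ((hf.continuousAt (isOpen_Ioo.mem_nhds hx)).tendsto).comp (tendsto_ceilGrid hx.1.le)

/-- Double right Riemann sums of a bounded continuous function on the open unit square converge to
the iterated integral. -/
theorem tendsto_riemannSum_Ioo_prod {h : ℝ → ℝ → ℝ}
    (hh : ContinuousOn (fun q : ℝ × ℝ => h q.1 q.2) (Set.Ioo (0 : ℝ) 1 ×ˢ Set.Ioo (0 : ℝ) 1))
    {M : ℝ} (hM : ∀ s ∈ Set.Ioo (0 : ℝ) 1, ∀ t ∈ Set.Ioo (0 : ℝ) 1, |h s t| ≤ M) :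
    Tendsto (fun n : ℕ => (∑ j ∈ Finset.range n,
        (∑ k ∈ Finset.range n, h ((j + 1) / (n + 1)) ((k + 1) / (n + 1))) / (n + 1)) / (n + 1))
      atTop (nhds (∫ s in Set.Ioo (0 : ℝ) 1, ∫ t in Set.Ioo (0 : ℝ) 1, h s t)) := by
  have hM0 : 0 ≤ M := (abs_nonneg _).trans (hM (1 / 2) (by norm_num) (1 / 2) (by norm_num))
  have hbound (n : ℕ) {s : ℝ} (hs : s ∈ Set.Ioo (0 : ℝ) 1) (t : ℝ) :
      ‖(Set.Ioo (0 : ℝ) 1).indicator (h s) (ceilGrid n t)‖ ≤ M := by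
    by_cases ht : ceilGrid n t ∈ Set.Ioo (0 : ℝ) 1
    · simpa [Set.indicator_of_mem ht] using hM s hs _ ht
    · simpa [Set.indicator_of_notMem ht] using hM0
  have hstep (n : ℕ) : ∫ x in Set.Ioo (0 : ℝ) 1, (Set.Ioo (0 : ℝ) 1).indicator
      (fun s => ∫ t in Set.Ioo (0 : ℝ) 1, (Set.Ioo (0 : ℝ) 1).indicator (h s) (ceilGrid n t))
        (ceilGrid n x) =
      (∑ j ∈ Finset.range n,
        (∑ k ∈ Finset.range n, h ((j + 1) / (n + 1)) ((k + 1) / (n + 1))) / (n + 1)) /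
          (n + 1) := by
    simp only [integral_indicator_comp_ceilGrid]
  refine Tendsto.congr hstep ?_
  refine tendsto_integral_of_dominated_convergence (fun _ => M)
    (fun n => (measurable_comp_ceilGrid _ n).aestronglyMeasurable) (integrable_const M)
    (fun n => ae_of_all _ fun x => ?_) ((ae_restrict_mem measurableSet_Ioo).mono fun x hx => ?_)
  · by_cases hx : ceilGrid n x ∈ Set.Ioo (0 : ℝ) 1
    · rw [Set.indicator_of_mem hx]
      simpa using norm_integral_le_of_norm_le_const (μ := volume.restrict (Set.Ioo (0 : ℝ) 1))
        (ae_of_all _ (hbound n hx))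
    · simpa [Set.indicator_of_notMem hx] using hM0
  · have hxt := tendsto_ceilGrid hx.1.le
    have hev := hxt.eventually (isOpen_Ioo.mem_nhds hx)
    refine Tendsto.congr' (hev.mono fun n hn =>
      (Set.indicator_of_mem (s := Set.Ioo (0 : ℝ) 1) hn _).symm) ?_
    refine tendsto_integral_filter_of_dominated_convergence (fun _ => M)
      (Eventually.of_forall fun n => (measurable_comp_ceilGrid _ n).aestronglyMeasurable)
      (hev.mono fun n hn => ae_of_all _ (hbound n hn)) (integrable_const M)
      ((ae_restrict_mem measurableSet_Ioo).mono fun t ht => ?_)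
    have htt := tendsto_ceilGrid ht.1.le
    refine Tendsto.congr' ((htt.eventually (isOpen_Ioo.mem_nhds ht)).mono fun n hn =>
      (Set.indicator_of_mem (s := Set.Ioo (0 : ℝ) 1) hn _).symm) ?_
    have hcont := hh.continuousAt ((isOpen_Ioo.prod isOpen_Ioo).mem_nhds (Set.mk_mem_prod hx ht))
    exact hcont.tendsto.comp (hxt.prodMk_nhds htt)

theorem phiLp_eq {τ p : ℝ} (hp : p ≠ 1) (hτ : τ ∈ Set.Icc (0 : ℝ) 1) (s : ℝ) :
    phiLp τ p s = p * ((τ - (if s < 0 then (1 : ℝ) else 0)) * |s| ^ (p - 1)) := by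
  rcases lt_trichotomy s 0 with hs | rfl | hs
  · simp only [phiLp, if_pos hs, Real.sign_of_neg hs, abs_of_nonpos (sub_nonpos.mpr hτ.2)]
    ring
  · simp [phiLp, Real.zero_rpow (sub_ne_zero.mpr hp)]
  · simp only [phiLp, if_neg hs.not_gt, Real.sign_of_pos hs, sub_zero, abs_of_nonneg hτ.1]
    ring

theorem ContinuousOn.eqOn_zero_of_setIntegral_Ioo_eq_zero {f : ℝ → ℝ} {a b M : ℝ}
    (hf : ContinuousOn f (Set.Ioo a b)) (hM : ∀ s ∈ Set.Ioo a b, |f s| ≤ M)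
    (h0 : ∀ s ∈ Set.Ioo a b, 0 ≤ f s) (hint : ∫ s in Set.Ioo a b, f s = 0) :
    Set.EqOn f 0 (Set.Ioo a b) := by
  have hfi : IntegrableOn f (Set.Ioo a b) :=
    Integrable.of_bound (hf.aestronglyMeasurable measurableSet_Ioo) M
      ((ae_restrict_mem measurableSet_Ioo).mono hM)
  refine Measure.eqOn_open_of_ae_eq (μ := volume) ?_ isOpen_Ioo hf continuousOn_const
  exact (setIntegral_eq_zero_iff_of_nonneg_ae
    ((ae_restrict_mem measurableSet_Ioo).mono h0) hfi).mp hint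

/-- Theorem 2.2: the limit, as K → ∞ with equally spaced weights τ_k = k/(K+1), of the
asymptotic variance factor of composite L^p-quantile regression. -/
theorem composite_Lp_quantile_asymptotic_variance_limit
    {Ω : Type*} [MeasurableSpace Ω] (μ : Measure Ω) [IsProbabilityMeasure μ]
    (p : ℝ) (hp1 : 1 < p) (hp2 : p ≤ 2)
    (ε : Ω → ℝ) (hεmeas : Measurable ε)
    -- ε has a continuous distribution
    (hcont : ∀ c : ℝ, μ {ω | ε ω = c} = 0)
    -- the s-th L^p-quantile b*_s of ε, continuous in s on (0,1)
    (bstar : ℝ → ℝ)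
    (hbstar : ∀ s ∈ Set.Ioo (0 : ℝ) 1, ∫ ω, phiLp s p (ε ω - bstar s) ∂μ = 0)
    (hbcont : ContinuousOn bstar (Set.Ioo (0 : ℝ) 1))
    -- g(s) = E[|s − 1_{ε<b*_s}|·|ε − b*_s|^{p−2}], bounded and continuous on (0,1)
    (g : ℝ → ℝ)
    (hg : ∀ s, g s = ∫ ω, |s - (if ε ω < bstar s then (1 : ℝ) else 0)| * |ε ω - bstar s| ^ (p - 2) ∂μ)
    (hgcont : ContinuousOn g (Set.Ioo (0 : ℝ) 1))
    (hgbdd : ∃ M : ℝ, ∀ s ∈ Set.Ioo (0 : ℝ) 1, |g s| ≤ M)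
    -- h(s,t) = E[(s − 1_{ε<b*_s})(t − 1_{ε<b*_t})·|ε − b*_s|^{p−1}·|ε − b*_t|^{p−1}],
    -- bounded and continuous on (0,1)²
    (h : ℝ → ℝ → ℝ)
    (hh : ∀ s t, h s t = ∫ ω, (s - (if ε ω < bstar s then (1 : ℝ) else 0)) *
      (t - (if ε ω < bstar t then (1 : ℝ) else 0)) *
      (|ε ω - bstar s| ^ (p - 1) * |ε ω - bstar t| ^ (p - 1)) ∂μ)
    (hhcont : ContinuousOn (fun q : ℝ × ℝ => h q.1 q.2)
      (Set.Ioo (0 : ℝ) 1 ×ˢ Set.Ioo (0 : ℝ) 1))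
    (hhbdd : ∃ M : ℝ, ∀ s ∈ Set.Ioo (0 : ℝ) 1, ∀ t ∈ Set.Ioo (0 : ℝ) 1, |h s t| ≤ M) :
    Tendsto (fun K : ℕ =>
        (∑ k' ∈ Finset.range K, ∑ k ∈ Finset.range K,
          ∫ ω, phiLp ((k' + 1 : ℝ) / (K + 1)) p (ε ω - bstar ((k' + 1 : ℝ) / (K + 1))) *
            phiLp ((k + 1 : ℝ) / (K + 1)) p (ε ω - bstar ((k + 1 : ℝ) / (K + 1))) ∂μ) /
        (∑ k ∈ Finset.range K,
          ∫ ω, psiLp ((k + 1 : ℝ) / (K + 1)) p (ε ω - bstar ((k + 1 : ℝ) / (K + 1))) ∂μ) ^ 2)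
      atTop
      (nhds ((∫ s in Set.Ioo (0 : ℝ) 1, ∫ t in Set.Ioo (0 : ℝ) 1, h s t) /
        ((p - 1) ^ 2 * (∫ s in Set.Ioo (0 : ℝ) 1, g s) ^ 2))) := by
  obtain ⟨Mg, hMg⟩ := hgbdd
  obtain ⟨Mh, hMh⟩ := hhbdd
  have hmem (K k : ℕ) (hk : k ∈ Finset.range K) : ((k : ℝ) + 1) / (K + 1) ∈ Set.Ioo (0 : ℝ) 1 := by
    have hkK : (k : ℝ) < K := by exact_mod_cast Finset.mem_range.mp hk
    refine ⟨by positivity, ?_⟩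
    rw [div_lt_one (by positivity)]
    linarith
  have hphi {s t : ℝ} (hs : s ∈ Set.Ioo (0 : ℝ) 1) (ht : t ∈ Set.Ioo (0 : ℝ) 1) :
      ∫ ω, phiLp s p (ε ω - bstar s) * phiLp t p (ε ω - bstar t) ∂μ = p ^ 2 * h s t := by
    rw [hh, ← integral_const_mul]
    refine integral_congr_ae (ae_of_all _ fun ω => ?_)
    simp only [phiLp_eq hp1.ne' (Set.Ioo_subset_Icc_self hs),
      phiLp_eq hp1.ne' (Set.Ioo_subset_Icc_self ht), sub_neg]
    ring
  have hpsi (s : ℝ) : ∫ ω, psiLp s p (ε ω - bstar s) ∂μ = p * (p - 1) * g s := by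
    rw [hg, ← integral_const_mul]
    refine integral_congr_ae (ae_of_all _ fun ω => ?_)
    simp only [psiLp, sub_neg]
    ring
  have hratio (K : ℕ) :
      (∑ k' ∈ Finset.range K, ∑ k ∈ Finset.range K,
        ∫ ω, phiLp ((k' + 1 : ℝ) / (K + 1)) p (ε ω - bstar ((k' + 1 : ℝ) / (K + 1))) *
          phiLp ((k + 1 : ℝ) / (K + 1)) p (ε ω - bstar ((k + 1 : ℝ) / (K + 1))) ∂μ) /
      (∑ k ∈ Finset.range K,
        ∫ ω, psiLp ((k + 1 : ℝ) / (K + 1)) p (ε ω - bstar ((k + 1 : ℝ) / (K + 1))) ∂μ) ^ 2 =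
      ((∑ j ∈ Finset.range K, (∑ k ∈ Finset.range K,
        h ((j + 1) / (K + 1)) ((k + 1) / (K + 1))) / (K + 1)) / (K + 1)) /
      ((p - 1) ^ 2 * ((∑ k ∈ Finset.range K, g ((k + 1) / (K + 1))) / (K + 1)) ^ 2) := by
    have hnum := Finset.sum_congr rfl fun k' hk' => Finset.sum_congr rfl fun k hk =>
      hphi (hmem K k' hk') (hmem K k hk)
    rw [hnum]
    simp only [hpsi, ← Finset.mul_sum, ← Finset.sum_div]
    have hK : (K : ℝ) + 1 ≠ 0 := by positivity
    have hp0 : p ≠ 0 := by positivity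
    rw [div_div (∑ j ∈ Finset.range K, _), div_pow, mul_div_assoc', ← sq, div_div_div_cancel_right₀ (pow_ne_zero 2 hK),
      mul_pow, mul_pow, mul_assoc, mul_div_mul_left _ _ (pow_ne_zero 2 hp0)]
  simp only [hratio]
  by_cases hint : ∫ s in Set.Ioo (0 : ℝ) 1, g s = 0
  · have hg0 := hgcont.eqOn_zero_of_setIntegral_Ioo_eq_zero hMg
      (fun s _ => by rw [hg]; exact integral_nonneg fun ω => by positivity) hint
    have hsum (K : ℕ) : ∑ k ∈ Finset.range K, g ((k + 1) / (K + 1)) = 0 :=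
      Finset.sum_eq_zero fun k hk => hg0 (hmem K k hk)
    simp [hsum, hint]
  · have hp : p - 1 ≠ 0 := sub_ne_zero.mpr hp1.ne'
    exact (tendsto_riemannSum_Ioo_prod hhcont hMh).div
      (((tendsto_riemannSum_Ioo hgcont hMg).pow 2).const_mul _)
      (mul_ne_zero (pow_ne_zero 2 hp) (pow_ne_zero 2 hint))
end

section
/- Let u be a real random variable with density f and let τ ∈ (0,1). Suppose (i) E|u|^{2(p−1)} < ∞ for all p ∈ (1, 1+Δ); (ii) for p ∈ (1, 1+Δ) and every constant c in a suitable neighborhood, E|u + c|^{p−2} < ∞; and (iii) f is differentiable with ∫|x|^{p−1}|f'(x)|dx < ∞ for p ∈ (1, 1+Δ). Then: (a) for any family of reals α_p with α_p → 0 as p → 1+, E[ψ_{τ,p}(u + α_p)] → f(0) as p → 1+; and (b) for any fixed constant α ∈ ℝ, E[ψ_{τ,p}(u + α)] → f(−α) as p → 1+. Equivalently, if q_τ denotes the τth quantile of u, then E[ψ_{τ,p}((u − q_τ) + α_p)] → f(q_τ) and E[ψ_{τ,p}((u − q_τ) + α)] → f(q_τ − α). -/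
open MeasureTheory ProbabilityTheory Filter Finset Real

theorem psiLp_of_pos (τ p : ℝ) {s : ℝ} (hτ : 0 ≤ τ) (hs : 0 < s) :
    psiLp τ p s = p * (p - 1) * τ * s ^ (p - 2) := by
  simp [psiLp, hs.not_gt, abs_of_pos hs, abs_of_nonneg hτ]

theorem psiLp_neg_of_pos (τ p : ℝ) {s : ℝ} (hτ : τ ≤ 1) (hs : 0 < s) :
    psiLp τ p (-s) = p * (p - 1) * (1 - τ) * s ^ (p - 2) := by
  simp [psiLp, hs, abs_of_pos hs, abs_of_nonpos (sub_nonpos.2 hτ)]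

theorem psiLp_nonneg (τ : ℝ) {p : ℝ} (hp : 1 ≤ p) (s : ℝ) : 0 ≤ psiLp τ p s := by
  have : 0 ≤ p - 1 := by linarith
  unfold psiLp
  positivity

@[fun_prop]
theorem measurable_psiLp (τ p : ℝ) : Measurable (psiLp τ p) := by
  have hite : Measurable fun s : ℝ => if s < 0 then (1 : ℝ) else 0 :=
    Measurable.ite measurableSet_Iio measurable_const measurable_const
  unfold psiLp
  fun_prop

theorem psiLp_le {τ p s δ : ℝ} (hτ : τ ∈ Set.Icc (0 : ℝ) 1) (hp : p ∈ Set.Icc (1 : ℝ) 2)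
    (hδ : 0 < δ) (hs : δ ≤ |s|) : psiLp τ p s ≤ p * (p - 1) * δ ^ (p - 2) := by
  obtain ⟨hτ0, hτ1⟩ := hτ
  obtain ⟨hp1, hp2⟩ := hp
  have hweight : |τ - (if s < 0 then (1 : ℝ) else 0)| ≤ 1 := by
    split_ifs <;> rw [abs_le] <;> constructor <;> linarith
  have hpow : |s| ^ (p - 2) ≤ δ ^ (p - 2) :=
    Real.rpow_le_rpow_of_nonpos hδ hs (by linarith)
  have hc : 0 ≤ p * (p - 1) := mul_nonneg (by linarith) (by linarith)
  exact mul_le_mul (mul_le_of_le_one_right hc hweight) hpow (by positivity) hc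

theorem intervalIntegrable_psiLp_zero_right {τ p b : ℝ} (hτ : 0 ≤ τ) (hp : 1 < p) (hb : 0 ≤ b) :
    IntervalIntegrable (psiLp τ p) volume 0 b := by
  refine ((intervalIntegral.intervalIntegrable_rpow' (by linarith : -1 < p - 2)).const_mul
    (p * (p - 1) * τ)).congr_uIoo fun x hx => ?_
  rw [Set.uIoo_of_le hb] at hx
  exact (psiLp_of_pos τ p hτ hx.1).symm

theorem intervalIntegrable_psiLp_zero_left {τ p c : ℝ} (hτ : τ ≤ 1) (hp : 1 < p) (hc : 0 ≤ c) :
    IntervalIntegrable (psiLp τ p) volume (-c) 0 := by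
  rw [IntervalIntegrable.iff_comp_neg, neg_zero, neg_neg]
  refine (((intervalIntegral.intervalIntegrable_rpow' (by linarith : -1 < p - 2)).const_mul
    (p * (p - 1) * (1 - τ))).congr_uIoo fun x hx => ?_).symm
  rw [Set.uIoo_of_le hc] at hx
  exact (psiLp_neg_of_pos τ p hτ hx.1).symm

theorem integral_psiLp {τ p b c : ℝ} (hτ : τ ∈ Set.Icc (0 : ℝ) 1) (hp : 1 < p)
    (hb : 0 ≤ b) (hc : 0 ≤ c) :
    ∫ x in (-c)..b, psiLp τ p x = p * ((1 - τ) * c ^ (p - 1) + τ * b ^ (p - 1)) := by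
  have hp0 : p - 1 ≠ 0 := by linarith
  have hpow (d : ℝ) : ∫ x in (0 : ℝ)..d, x ^ (p - 2) = d ^ (p - 1) / (p - 1) := by
    rw [integral_rpow (.inl (by linarith)), show p - 2 + 1 = p - 1 by ring, Real.zero_rpow hp0,
      sub_zero]
  have hleft : ∫ x in (-c)..0, psiLp τ p x = p * (1 - τ) * c ^ (p - 1) := by
    rw [← neg_zero, ← intervalIntegral.integral_comp_neg,
      intervalIntegral.integral_congr_Ioo_of_le hc fun x hx => psiLp_neg_of_pos τ p hτ.2 hx.1,
      intervalIntegral.integral_const_mul, hpow]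
    field_simp
  have hright : ∫ x in (0 : ℝ)..b, psiLp τ p x = p * τ * b ^ (p - 1) := by
    rw [intervalIntegral.integral_congr_Ioo_of_le hb fun x hx => psiLp_of_pos τ p hτ.1 hx.1,
      intervalIntegral.integral_const_mul, hpow]
    field_simp
  rw [← intervalIntegral.integral_add_adjacent_intervals
    (intervalIntegrable_psiLp_zero_left hτ.2 hp hc)
    (intervalIntegrable_psiLp_zero_right hτ.1 hp hb), hleft, hright]
  ring

/-- As `p → 1+`, the translates `psiLp τ p (· + α p)` with `α p → a` are an approximate identity
at `-a`. -/
theorem tendsto_integral_psiLp_add_smul {τ a : ℝ} (hτ : τ ∈ Set.Icc (0 : ℝ) 1) {g α : ℝ → ℝ}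
    (hg : Integrable g) (hga : ContinuousAt g (-a))
    (hα : Tendsto α (nhdsWithin 1 (Set.Ioi 1)) (nhds a)) :
    Tendsto (fun p : ℝ => ∫ x, psiLp τ p (x + α p) • g x)
      (nhdsWithin 1 (Set.Ioi 1)) (nhds (g (-a))) := by
  have hgt : ∀ᶠ p : ℝ in nhdsWithin 1 (Set.Ioi 1), 1 < p := self_mem_nhdsWithin
  have hlt : ∀ᶠ p : ℝ in nhdsWithin 1 (Set.Ioi 1), p < 2 :=
    nhdsWithin_le_nhds (Iio_mem_nhds one_lt_two)
  have hid : Tendsto (fun p : ℝ => p) (nhdsWithin 1 (Set.Ioi 1)) (nhds 1) :=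
    tendsto_id.mono_left nhdsWithin_le_nhds
  refine tendsto_integral_peak_smul_of_integrable_of_tendsto (x₀ := -a)
    (t := Set.Ioc (-a - 1) (-a + 1)) measurableSet_Ioc
    (Ioc_mem_nhds (by linarith) (by linarith)) measure_Ioc_lt_top.ne ?_ ?_ ?_ ?_ hg hga
  · filter_upwards [hgt] with p hp x using psiLp_nonneg τ hp.le _
  · intro U hU haU
    obtain ⟨δ, hδ, hball⟩ := Metric.isOpen_iff.1 hU _ haU
    have hbound : Tendsto (fun p : ℝ => p * (p - 1) * (δ / 2) ^ (p - 2))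
        (nhdsWithin 1 (Set.Ioi 1)) (nhds 0) := by
      have hpow : Tendsto (fun p : ℝ => (δ / 2) ^ (p - 2)) (nhdsWithin 1 (Set.Ioi 1))
          (nhds ((δ / 2) ^ ((1 : ℝ) - 2))) :=
        tendsto_const_nhds.rpow (hid.sub_const 2) (.inl (by positivity))
      simpa using (hid.mul (hid.sub_const 1)).mul hpow
    rw [Metric.tendstoUniformlyOn_iff]
    intro ε hε
    filter_upwards [hgt, hlt, hbound.eventually_lt_const hε,
      Metric.tendsto_nhds.1 hα (δ / 2) (by positivity)] with p hp1 hp2 hpε hαp x hx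
    have hxa : δ ≤ |x + a| := by
      by_contra! h
      exact hx (hball (by simpa [Real.dist_eq] using h))
    have hxα : δ / 2 ≤ |x + α p| := by
      rw [Real.dist_eq] at hαp
      have := abs_sub_abs_le_abs_sub (x + a) (x + α p)
      rw [add_sub_add_left_eq_sub, abs_sub_comm] at this
      linarith
    rw [Pi.zero_apply, dist_zero_left, Real.norm_of_nonneg (psiLp_nonneg τ hp1.le _)]
    exact (psiLp_le hτ ⟨hp1.le, hp2.le⟩ (by positivity) hxα).trans_lt hpε
  · have hε : Tendsto (fun p => α p - a) (nhdsWithin 1 (Set.Ioi 1)) (nhds 0) := by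
      simpa using hα.sub_const a
    have hexp : Tendsto (fun p : ℝ => p - 1) (nhdsWithin 1 (Set.Ioi 1)) (nhds 0) := by
      simpa using hid.sub_const 1
    have hlim : Tendsto (fun p : ℝ => p * ((1 - τ) * (1 - (α p - a)) ^ (p - 1) +
        τ * (1 + (α p - a)) ^ (p - 1))) (nhdsWithin 1 (Set.Ioi 1)) (nhds 1) := by
      have hc := (hε.const_sub 1).rpow hexp (.inl (by norm_num))
      have hb := (hε.const_add 1).rpow hexp (.inl (by norm_num))
      simpa using hid.mul ((hc.const_mul (1 - τ)).add (hb.const_mul τ))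
    refine hlim.congr' ?_
    filter_upwards [hgt, Metric.tendsto_nhds.1 hε 1 one_pos] with p hp hαp
    rw [dist_zero_right, Real.norm_eq_abs, abs_lt] at hαp
    rw [← intervalIntegral.integral_of_le (by linarith),
      intervalIntegral.integral_comp_add_right (psiLp τ p),
      ← integral_psiLp hτ hp (by linarith) (by linarith)]
    congr 1 <;> ring
  · exact .of_forall fun p => Measurable.aestronglyMeasurable (by fun_prop)

theorem integrable_of_map_eq_withDensity {Ω : Type*} [MeasurableSpace Ω] {μ : Measure Ω}
    [IsFiniteMeasure μ] {u : Ω → ℝ} {f : ℝ → ℝ} (hf : Measurable f) (hf0 : ∀ s, 0 ≤ f s)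
    (hdens : μ.map u = volume.withDensity (fun s => ENNReal.ofReal (f s))) :
    Integrable f := by
  refine ⟨hf.aestronglyMeasurable, ?_⟩
  rw [hasFiniteIntegral_iff_ofReal (.of_forall hf0), ← setLIntegral_univ,
    ← withDensity_apply _ MeasurableSet.univ, ← hdens]
  exact measure_lt_top _ _

theorem integral_comp_of_map_eq_withDensity {Ω : Type*} [MeasurableSpace Ω] {μ : Measure Ω}
    {u : Ω → ℝ} (hu : Measurable u) {f : ℝ → ℝ} (hf : Measurable f) (hf0 : ∀ s, 0 ≤ f s)
    (hdens : μ.map u = volume.withDensity (fun s => ENNReal.ofReal (f s)))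
    {h : ℝ → ℝ} (hh : Measurable h) :
    ∫ ω, h (u ω) ∂μ = ∫ x, h x • f x := by
  rw [← integral_map hu.aemeasurable hh.aestronglyMeasurable, hdens,
    integral_withDensity_eq_integral_toReal_smul hf.ennreal_ofReal
      (.of_forall fun _ => ENNReal.ofReal_lt_top)]
  simp [ENNReal.toReal_ofReal (hf0 _), mul_comm]

/-- Lemma 2: limits of E[ψ_{τ,p}(u + α_p)] and E[ψ_{τ,p}(u + α)] as p → 1+. -/
theorem psi_expectation_limit
    {Ω : Type*} [MeasurableSpace Ω] (μ : Measure Ω) [IsProbabilityMeasure μ]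
    (Δ : ℝ) (hΔ : 0 < Δ) (τ : ℝ) (hτ : τ ∈ Set.Ioo (0 : ℝ) 1)
    (u : Ω → ℝ) (humeas : Measurable u)
    (f : ℝ → ℝ) (hf0 : ∀ s, 0 ≤ f s)
    (hdens : μ.map u = volume.withDensity (fun s => ENNReal.ofReal (f s)))
    -- (i)
    (hi : ∀ p ∈ Set.Ioo (1 : ℝ) (1 + Δ), Integrable (fun ω => |u ω| ^ (2 * (p - 1))) μ)
    -- (ii)
    (hii : ∀ c : ℝ, ∀ p ∈ Set.Ioo (1 : ℝ) (1 + Δ),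
      Integrable (fun ω => |u ω + c| ^ (p - 2)) μ)
    -- (iii)
    (hfdiff : Differentiable ℝ f)
    (hiii : ∀ p ∈ Set.Ioo (1 : ℝ) (1 + Δ),
      Integrable (fun s => |s| ^ (p - 1) * |deriv f s|) volume) :
    -- (a) for every family α_p → 0 as p → 1+, E[ψ_{τ,p}(u + α_p)] → f(0)
    (∀ α : ℝ → ℝ, Tendsto α (nhdsWithin 1 (Set.Ioi 1)) (nhds 0) →
      Tendsto (fun p : ℝ => ∫ ω, psiLp τ p (u ω + α p) ∂μ)
        (nhdsWithin 1 (Set.Ioi 1)) (nhds (f 0))) ∧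
    -- (b) for every fixed constant α, E[ψ_{τ,p}(u + α)] → f(−α)
    (∀ α : ℝ,
      Tendsto (fun p : ℝ => ∫ ω, psiLp τ p (u ω + α) ∂μ)
        (nhdsWithin 1 (Set.Ioi 1)) (nhds (f (-α)))) := by
  have hfm : Measurable f := hfdiff.continuous.measurable
  have key (a : ℝ) (α : ℝ → ℝ) (hα : Tendsto α (nhdsWithin 1 (Set.Ioi 1)) (nhds a)) :
      Tendsto (fun p : ℝ => ∫ ω, psiLp τ p (u ω + α p) ∂μ)
        (nhdsWithin 1 (Set.Ioi 1)) (nhds (f (-a))) := by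
    refine (tendsto_integral_psiLp_add_smul (Set.Ioo_subset_Icc_self hτ)
      (integrable_of_map_eq_withDensity hfm hf0 hdens)
      hfdiff.continuous.continuousAt hα).congr fun p => ?_
    exact (integral_comp_of_map_eq_withDensity humeas hfm hf0 hdens
      (h := fun x => psiLp τ p (x + α p)) (by fun_prop)).symm
  exact ⟨fun α hα => by simpa using key 0 α hα, fun α => key α (fun _ => α) tendsto_const_nhds⟩
end

section
/- Let ε be a real random variable with E|ε|^{p−1} < ∞ for all p ∈ (1, 1+Δ), let τ ∈ (0,1), and for p ∈ (1, 1+Δ) let q^{lp}_ε(τ) be the (unique) minimizer over s ∈ ℝ of Q^{lp}(s) = E[η_{τ,p}(ε − s) − η_{τ,p}(ε)]; suppose also that the τth quantile q_ε(τ) is the unique minimizer over s of Q(s) = E[η_{τ,1}(ε − s) − η_{τ,1}(ε)]. Then q^{lp}_ε(τ) → q_ε(τ) as p → 1+. -/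
open MeasureTheory ProbabilityTheory Filter Finset Real

lemma etaLp_eq_max_rpow {τ p : ℝ} (hτ : τ ∈ Set.Ioo (0 : ℝ) 1) (hp : 1 ≤ p) (s : ℝ) :
    etaLp τ p s = τ * max s 0 ^ p + (1 - τ) * max (-s) 0 ^ p := by
  have hp0 : p ≠ 0 := by linarith
  unfold etaLp
  rcases lt_or_ge s 0 with h | h
  · rw [if_pos h, max_eq_right h.le, max_eq_left (by linarith), abs_of_neg h,
      abs_of_neg (by linarith [hτ.2]), zero_rpow hp0]
    ring
  · rw [if_neg h.not_gt, max_eq_left h, max_eq_right (by linarith), abs_of_nonneg h,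
      abs_of_nonneg (by linarith [hτ.1]), zero_rpow hp0]
    ring

lemma abs_rpow_sub_rpow_le {a b M p : ℝ} (hp : 1 ≤ p) (ha : a ∈ Set.Icc 0 M)
    (hb : b ∈ Set.Icc 0 M) : |a ^ p - b ^ p| ≤ p * M ^ (p - 1) * |a - b| := by
  refine (convex_Icc (0 : ℝ) M).norm_image_sub_le_of_norm_hasDerivWithin_le
    (f := fun x : ℝ => x ^ p) (f' := fun x : ℝ => p * x ^ (p - 1))
    (fun x _ => (hasDerivAt_rpow_const (Or.inr hp)).hasDerivWithinAt) (fun x hx => ?_) hb ha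
  rw [norm_of_nonneg (mul_nonneg (by linarith) (rpow_nonneg hx.1 _))]
  exact mul_le_mul_of_nonneg_left (rpow_le_rpow hx.1 hx.2 (by linarith)) (by linarith)

lemma abs_max_zero_rpow_sub_le {p : ℝ} (hp : 1 ≤ p) (x y : ℝ) :
    |max (x - y) 0 ^ p - max x 0 ^ p| ≤ p * (|x| + |y|) ^ (p - 1) * |y| := by
  have hx := le_abs_self x
  have hy := neg_le_abs y
  have hx0 := abs_nonneg x
  have hy0 := abs_nonneg y
  refine (abs_rpow_sub_rpow_le (M := |x| + |y|) hp
    ⟨le_max_right _ _, max_le (by linarith) (by linarith)⟩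
    ⟨le_max_right _ _, max_le (by linarith) (by linarith)⟩).trans ?_
  refine mul_le_mul_of_nonneg_left ?_ (by positivity)
  simpa using abs_max_sub_max_le_abs (x - y) x 0

lemma abs_etaLp_sub_le {τ p : ℝ} (hτ : τ ∈ Set.Ioo (0 : ℝ) 1) (hp : 1 ≤ p) (e s : ℝ) :
    |etaLp τ p (e - s) - etaLp τ p e| ≤ p * (|e| + |s|) ^ (p - 1) * |s| := by
  have h1 := abs_le.1 (abs_max_zero_rpow_sub_le hp e s)
  have h2 := abs_le.1 (abs_max_zero_rpow_sub_le hp (-e) (-s))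
  rw [abs_neg, abs_neg, show -e - -s = -(e - s) by ring] at h2
  rw [etaLp_eq_max_rpow hτ hp, etaLp_eq_max_rpow hτ hp, abs_le]
  have hτ0 := hτ.1
  have hτ1 := hτ.2
  constructor <;> nlinarith

/-- A bound on the increments of the loss that is uniform over `p ∈ [1, 1 + r]`. -/
lemma abs_etaLp_sub_le_of_le {τ p r : ℝ} (hτ : τ ∈ Set.Ioo (0 : ℝ) 1) (hp : 1 ≤ p)
    (hpr : p ≤ 1 + r) (hr : r ≤ 1) (e s : ℝ) :
    |etaLp τ p (e - s) - etaLp τ p e| ≤ 2 * (|e| ^ r + (|s| + 1) ^ r) * |s| := by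
  refine (abs_etaLp_sub_le hτ hp e s).trans (mul_le_mul_of_nonneg_right ?_ (abs_nonneg s))
  have he := abs_nonneg e
  have hs := abs_nonneg s
  have h : (|e| + |s|) ^ (p - 1) ≤ |e| ^ r + (|s| + 1) ^ r :=
    calc (|e| + |s|) ^ (p - 1) ≤ (|e| + (|s| + 1)) ^ (p - 1) :=
          rpow_le_rpow (by positivity) (by linarith) (by linarith)
      _ ≤ (|e| + (|s| + 1)) ^ r := rpow_le_rpow_of_exponent_le (by linarith) (by linarith)
      _ ≤ |e| ^ r + (|s| + 1) ^ r :=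
          rpow_add_le_add_rpow he (by linarith) (by linarith) hr
  exact mul_le_mul (by linarith) h (by positivity) (by norm_num)

lemma convexOn_max_zero_rpow {p : ℝ} (hp : 1 ≤ p) :
    ConvexOn ℝ Set.univ (fun s : ℝ => max s 0 ^ p) := by
  refine ⟨convex_univ, fun x _ y _ a b ha hb hab => ?_⟩
  have hx := le_max_right x 0
  have hy := le_max_right y 0
  refine le_trans (rpow_le_rpow (le_max_right _ _) (max_le ?_ ?_) (by linarith))
    ((convexOn_rpow hp).2 hx hy ha hb hab)
  · exact add_le_add (mul_le_mul_of_nonneg_left (le_max_left x 0) ha)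
      (mul_le_mul_of_nonneg_left (le_max_left y 0) hb)
  · exact add_nonneg (mul_nonneg ha hx) (mul_nonneg hb hy)

lemma convexOn_etaLp {τ p : ℝ} (hτ : τ ∈ Set.Ioo (0 : ℝ) 1) (hp : 1 ≤ p) :
    ConvexOn ℝ Set.univ (etaLp τ p) := by
  have hneg : ConvexOn ℝ Set.univ (fun s : ℝ => max (-s) 0 ^ p) :=
    (convexOn_max_zero_rpow hp).comp_linearMap (-LinearMap.id)
  rw [funext (etaLp_eq_max_rpow hτ hp)]
  exact ((convexOn_max_zero_rpow hp).smul hτ.1.le).add (hneg.smul (sub_nonneg.2 hτ.2.le))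

lemma measurable_etaLp (τ p : ℝ) : Measurable (etaLp τ p) := by
  unfold etaLp
  have h : Measurable (fun s : ℝ => if s < 0 then (1 : ℝ) else 0) :=
    Measurable.ite measurableSet_Iio measurable_const measurable_const
  exact (continuous_abs.measurable.comp (measurable_const.sub h)).mul
    (continuous_abs.measurable.pow_const p)

section

variable {Ω : Type*} [MeasurableSpace Ω] {μ : Measure Ω} [IsProbabilityMeasure μ] {ε : Ω → ℝ}

lemma integrable_etaLp_sub {τ p r : ℝ} (hτ : τ ∈ Set.Ioo (0 : ℝ) 1) (hp : 1 ≤ p)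
    (hpr : p ≤ 1 + r) (hr : r ≤ 1) (hε : Measurable ε)
    (hint : Integrable (fun ω => |ε ω| ^ r) μ) (s : ℝ) :
    Integrable (fun ω => etaLp τ p (ε ω - s) - etaLp τ p (ε ω)) μ :=
  Integrable.mono' (((hint.add (integrable_const ((|s| + 1) ^ r))).const_mul 2).mul_const |s|)
    (((measurable_etaLp τ p).comp (hε.sub_const s)).sub
      ((measurable_etaLp τ p).comp hε)).aestronglyMeasurable
    (Eventually.of_forall fun ω => abs_etaLp_sub_le_of_le hτ hp hpr hr (ε ω) s)

lemma convexOn_integral_etaLp_sub {τ p r : ℝ} (hτ : τ ∈ Set.Ioo (0 : ℝ) 1) (hp : 1 ≤ p)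
    (hpr : p ≤ 1 + r) (hr : r ≤ 1) (hε : Measurable ε)
    (hint : Integrable (fun ω => |ε ω| ^ r) μ) :
    ConvexOn ℝ Set.univ (fun s => ∫ ω, (etaLp τ p (ε ω - s) - etaLp τ p (ε ω)) ∂μ) := by
  have hI := integrable_etaLp_sub hτ hp hpr hr hε hint
  refine ⟨convex_univ, fun x _ y _ a b ha hb hab => ?_⟩
  simp only [smul_eq_mul]
  rw [← integral_const_mul, ← integral_const_mul,
    ← integral_add ((hI x).const_mul a) ((hI y).const_mul b)]
  refine integral_mono (hI _) (((hI x).const_mul a).add ((hI y).const_mul b)) fun ω => ?_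
  have h := (convexOn_etaLp hτ hp).2 (Set.mem_univ (ε ω - x)) (Set.mem_univ (ε ω - y)) ha hb hab
  simp only [smul_eq_mul] at h
  have hb' : b = 1 - a := by linarith
  subst hb'
  rw [show a * (ε ω - x) + (1 - a) * (ε ω - y) = ε ω - (a * x + (1 - a) * y) by ring] at h
  show _ ≤ a * (etaLp τ p (ε ω - x) - etaLp τ p (ε ω)) +
    (1 - a) * (etaLp τ p (ε ω - y) - etaLp τ p (ε ω))
  linarith

lemma tendsto_etaLp_one (τ s : ℝ) :
    Tendsto (fun p => etaLp τ p s) (nhdsWithin 1 (Set.Ioi 1)) (nhds (etaLp τ 1 s)) :=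
  ((continuousAt_const_rpow' one_ne_zero).tendsto.mono_left nhdsWithin_le_nhds).const_mul _

lemma tendsto_integral_etaLp_sub {τ r : ℝ} (hτ : τ ∈ Set.Ioo (0 : ℝ) 1) (hr0 : 0 < r)
    (hr : r ≤ 1) (hε : Measurable ε) (hint : Integrable (fun ω => |ε ω| ^ r) μ) (s : ℝ) :
    Tendsto (fun p => ∫ ω, (etaLp τ p (ε ω - s) - etaLp τ p (ε ω)) ∂μ)
      (nhdsWithin 1 (Set.Ioi 1)) (nhds (∫ ω, (etaLp τ 1 (ε ω - s) - etaLp τ 1 (ε ω)) ∂μ)) := by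
  refine tendsto_integral_filter_of_dominated_convergence
    (fun ω => 2 * (|ε ω| ^ r + (|s| + 1) ^ r) * |s|) ?_ ?_ ?_ ?_
  · exact Eventually.of_forall fun p => (((measurable_etaLp τ p).comp (hε.sub_const s)).sub
      ((measurable_etaLp τ p).comp hε)).aestronglyMeasurable
  · filter_upwards [Ioo_mem_nhdsGT (show (1 : ℝ) < 1 + r by linarith)] with p hp
    exact Eventually.of_forall fun ω =>
      abs_etaLp_sub_le_of_le hτ hp.1.le hp.2.le hr (ε ω) s
  · exact ((hint.add (integrable_const _)).const_mul 2).mul_const _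
  · exact Eventually.of_forall fun ω =>
      (tendsto_etaLp_one τ (ε ω - s)).sub (tendsto_etaLp_one τ (ε ω))

end

/-- If a convex function on `ℝ` is larger at `x - δ` and `x + δ` than at `x`, its minimizers lie
within `δ` of `x`. -/
lemma ConvexOn.abs_sub_lt_of_lt_of_lt {f : ℝ → ℝ} (hf : ConvexOn ℝ Set.univ f) {x q δ : ℝ}
    (hδ : 0 < δ) (hq : f q ≤ f x) (hl : f x < f (x - δ)) (hr : f x < f (x + δ)) :
    |q - x| < δ := by
  rw [abs_lt]
  constructor
  · by_contra! h
    have := hf.le_max_of_mem_Icc (Set.mem_univ q) (Set.mem_univ x) (z := x - δ)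
      ⟨by linarith, by linarith⟩
    rw [max_eq_right hq] at this
    linarith
  · by_contra! h
    have := hf.le_max_of_mem_Icc (Set.mem_univ x) (Set.mem_univ q) (z := x + δ)
      ⟨by linarith, by linarith⟩
    rw [max_eq_left hq] at this
    linarith

/-- Lemma 4: the τth L^p-quantile converges to the τth quantile as p → 1+. -/
theorem Lp_quantile_tendsto_quantile
    {Ω : Type*} [MeasurableSpace Ω] (μ : Measure Ω) [IsProbabilityMeasure μ]
    (Δ : ℝ) (hΔ : 0 < Δ) (τ : ℝ) (hτ : τ ∈ Set.Ioo (0 : ℝ) 1)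
    (ε : Ω → ℝ) (hεmeas : Measurable ε)
    (hmom : ∀ p ∈ Set.Ioo (1 : ℝ) (1 + Δ), Integrable (fun ω => |ε ω| ^ (p - 1)) μ)
    -- q^{lp}_ε(τ): the unique minimizer of Q^{lp}(s) = E[η_{τ,p}(ε − s) − η_{τ,p}(ε)]
    (qlp : ℝ → ℝ)
    (hqlp : ∀ p ∈ Set.Ioo (1 : ℝ) (1 + Δ), ∀ s : ℝ, s ≠ qlp p →
      (∫ ω, (etaLp τ p (ε ω - qlp p) - etaLp τ p (ε ω)) ∂μ) <
        ∫ ω, (etaLp τ p (ε ω - s) - etaLp τ p (ε ω)) ∂μ)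
    -- q_ε(τ): the unique minimizer of Q(s) = E[η_{τ,1}(ε − s) − η_{τ,1}(ε)]
    (qτ : ℝ)
    (hqτ : ∀ s : ℝ, s ≠ qτ →
      (∫ ω, (etaLp τ 1 (ε ω - qτ) - etaLp τ 1 (ε ω)) ∂μ) <
        ∫ ω, (etaLp τ 1 (ε ω - s) - etaLp τ 1 (ε ω)) ∂μ) :
    Tendsto qlp (nhdsWithin 1 (Set.Ioi 1)) (nhds qτ) := by
  obtain ⟨r, hr0, hrΔ⟩ := exists_between (lt_min hΔ one_pos)
  have hr1 : r ≤ 1 := (hrΔ.trans_le (min_le_right _ _)).le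
  have hrΔ' : r < Δ := hrΔ.trans_le (min_le_left _ _)
  have hint : Integrable (fun ω => |ε ω| ^ r) μ := by
    simpa using hmom (1 + r) ⟨by linarith, by linarith⟩
  have hlim := tendsto_integral_etaLp_sub hτ hr0 hr1 hεmeas hint
  rw [Metric.tendsto_nhds]
  intro δ hδ
  filter_upwards [Ioo_mem_nhdsGT (show (1 : ℝ) < 1 + r by linarith),
    (hlim qτ).eventually_lt (hlim (qτ - δ)) (hqτ _ (by linarith)),
    (hlim qτ).eventually_lt (hlim (qτ + δ)) (hqτ _ (by linarith))] with p hp hl hr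
  refine (convexOn_integral_etaLp_sub hτ hp.1.le hp.2.le hr1 hεmeas hint).abs_sub_lt_of_lt_of_lt
    hδ ?_ hl hr
  rcases eq_or_ne qτ (qlp p) with h | h
  · rw [h]
  · exact (hqlp p ⟨hp.1, hp.2.trans (by linarith)⟩ qτ h).le
end
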